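/- Let V_0 : ℤ → ℝ, ε ∈ ℝ, and let ψ_1 : ℤ → ℝ be a nowhere-vanishing sequence satisfying −Δ²ψ_1(n) + V_0(n)ψ_1(n) = ε ψ_1(n+2) for all n ∈ ℤ. Set f_1(n) = Δψ_1(n)/ψ_1(n) and V_1(n) = V_0(n+1) − 2Δf_1(n+1). If φ_0 : ℤ → ℝ satisfies −Δ²φ_0(n) + V_0(n)φ_0(n) = 0 for all n ∈ ℤ, then the sequence φ_1(n) = −Δφ_0(n) + f_1(n)φ_0(n) satisfies −Δ²φ_1(n) + V_1(n)φ_1(n) = 0 for all n ∈ ℤ. -/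

import Mathlib

/-- With f₁ = Δψ₁/ψ₁ from a nowhere-vanishing solution of
−Δ²ψ₁ + V₀ψ₁ = εψ₁(·+2), and V₁(n) = V₀(n+1) − 2Δf₁(n+1), any solution φ₀ of
−Δ²φ₀ + V₀φ₀ = 0 is mapped by φ₁ = −Δφ₀ + f₁φ₀ to a solution of −Δ²φ₁ + V₁φ₁ = 0. -/
theorem stmt_3 (V0 : ℤ → ℝ) (ε : ℝ) (ψ1 : ℤ → ℝ)
    (hne : ∀ n : ℤ, ψ1 n ≠ 0)
    (hψ : ∀ n : ℤ, -(ψ1 (n+2) - 2 * ψ1 (n+1) + ψ1 n) + V0 n * ψ1 n = ε * ψ1 (n+2))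
    (f1 : ℤ → ℝ)
    (hf : ∀ n : ℤ, f1 n = (ψ1 (n+1) - ψ1 n) / ψ1 n)
    (V1 : ℤ → ℝ)
    (hV1 : ∀ n : ℤ, V1 n = V0 (n+1) - 2 * (f1 (n+2) - f1 (n+1)))
    (φ0 : ℤ → ℝ)
    (hφ0 : ∀ n : ℤ, -(φ0 (n+2) - 2 * φ0 (n+1) + φ0 n) + V0 n * φ0 n = 0)
    (φ1 : ℤ → ℝ)
    (hφ1 : ∀ n : ℤ, φ1 n = -(φ0 (n+1) - φ0 n) + f1 n * φ0 n) :
    ∀ n : ℤ, -(φ1 (n+2) - 2 * φ1 (n+1) + φ1 n) + V1 n * φ1 n = 0 := by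
  intro n
  have riccati : ∀ m : ℤ,
      (1 + ε) * (f1 (m+1) + 1) * (f1 m + 1) - 2 * (f1 m + 1) + (1 - V0 m) = 0 := by
    intro m
    have h0 := hne m
    have h1 := hne (m+1)
    have h := hψ m
    rw [hf m, hf (m+1), show m + 1 + 1 = m + 2 by ring]
    field_simp
    linear_combination -ψ1 (m+1) * h
  have hR := riccati n
  have hR' := riccati (n+1)
  have hP := hφ0 n
  have hP' := hφ0 (n+1)
  rw [hV1 n, hφ1 (n+2), hφ1 (n+1), hφ1 n]
  rw [show n + 1 + 1 = n + 2 by ring] at hR' hP' ⊢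
  rw [show n + 1 + 2 = n + 2 + 1 by ring] at hP'
  linear_combination -hP' + (f1 (n+2) + 1) * hP + φ0 n * (f1 (n+2) + 1) * hR
    - φ0 n * (f1 n + 1) * hR'
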